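/- Let A be a commutative ring in which 2 is invertible, let π ∈ A, and let p, q be nonnegative integers. Let P₁ be the quotient of the polynomial ring over A in the entries of matrices X, Y (of size p×q) and Z, W (of size q×q) by the ideal generated by all entries of W + Wᵀ and of (Z − Zᵀ + XᵀY − YᵀX)·W − 2π·I_q. Let P₂ be the quotient of the polynomial ring over A in the entries of two q×q matrices T, W by the ideal generated by all entries of W + Wᵀ, T + Tᵀ, and T·W − 2π·I_q. Then P₁ is isomorphic, as an A-algebra, to a polynomial ring over P₂ in 2pq + q(q+1)/2 variables. -/

import Mathlib

/-!
STATEMENT 5: Let `A` be a commutative ring in which `2` is invertible, let `π ∈ A`, and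
let `p, q` be nonnegative integers.  Let `P₁` be the quotient of the polynomial ring
over `A` in the entries of matrices `X, Y` (of size `p × q`) and `Z, W` (of size
`q × q`) by the ideal generated by all entries of `W + Wᵀ` and of
`(Z − Zᵀ + XᵀY − YᵀX)·W − 2π·I_q`.  Let `P₂` be the quotient of the polynomial ring
over `A` in the entries of two `q × q` matrices `T, W` by the ideal generated by all
entries of `W + Wᵀ`, `T + Tᵀ` and `T·W − 2π·I_q`.  Then `P₁` is isomorphic, as an
`A`-algebra, to a polynomial ring over `P₂` in `2pq + q(q+1)/2` variables.
-/

open Matrix MvPolynomial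

noncomputable section

/-- Variable indices for `P₁`: four blocks for the matrices `X`, `Y`, `Z`, `W`. -/
abbrev Vars1 (p q : ℕ) :=
  (Fin p × Fin q) ⊕ ((Fin p × Fin q) ⊕ ((Fin q × Fin q) ⊕ (Fin q × Fin q)))

/-- Variable indices for `P₂`: two blocks for the matrices `T`, `W`. -/
abbrev Vars2 (q : ℕ) := (Fin q × Fin q) ⊕ (Fin q × Fin q)

section GenericMatrices

variable (A : Type*) [CommRing A] (p q : ℕ)

/-- The generic `p × q` matrix `X`. -/
def Xmat : Matrix (Fin p) (Fin q) (MvPolynomial (Vars1 p q) A) :=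
  Matrix.of fun i j => MvPolynomial.X (Sum.inl (i, j))

/-- The generic `p × q` matrix `Y`. -/
def Ymat : Matrix (Fin p) (Fin q) (MvPolynomial (Vars1 p q) A) :=
  Matrix.of fun i j => MvPolynomial.X (Sum.inr (Sum.inl (i, j)))

/-- The generic `q × q` matrix `Z`. -/
def Zmat : Matrix (Fin q) (Fin q) (MvPolynomial (Vars1 p q) A) :=
  Matrix.of fun i j => MvPolynomial.X (Sum.inr (Sum.inr (Sum.inl (i, j))))

/-- The generic `q × q` matrix `W` (in the ring of `P₁`). -/
def Wmat1 : Matrix (Fin q) (Fin q) (MvPolynomial (Vars1 p q) A) :=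
  Matrix.of fun i j => MvPolynomial.X (Sum.inr (Sum.inr (Sum.inr (i, j))))

/-- The generic `q × q` matrix `T` (in the ring of `P₂`). -/
def Tmat2 : Matrix (Fin q) (Fin q) (MvPolynomial (Vars2 q) A) :=
  Matrix.of fun i j => MvPolynomial.X (Sum.inl (i, j))

/-- The generic `q × q` matrix `W` (in the ring of `P₂`). -/
def Wmat2 : Matrix (Fin q) (Fin q) (MvPolynomial (Vars2 q) A) :=
  Matrix.of fun i j => MvPolynomial.X (Sum.inr (i, j))

end GenericMatrices

/-- The set of entries of a matrix. -/
def matEntries {α : Type*} {a b : ℕ} (M : Matrix (Fin a) (Fin b) α) : Set α :=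
  Set.range fun x : Fin a × Fin b => M x.1 x.2

variable (A : Type*) [CommRing A] (π : A) (p q : ℕ)

/-- The ideal generated by all entries of `W + Wᵀ` and `(Z − Zᵀ + XᵀY − YᵀX)·W − 2π·I_q`. -/
def ideal1 : Ideal (MvPolynomial (Vars1 p q) A) :=
  Ideal.span (matEntries (Wmat1 A p q + (Wmat1 A p q)ᵀ) ∪
    matEntries ((Zmat A p q - (Zmat A p q)ᵀ + (Xmat A p q)ᵀ * Ymat A p q -
        (Ymat A p q)ᵀ * Xmat A p q) * Wmat1 A p q -
      (2 * π) • (1 : Matrix (Fin q) (Fin q) (MvPolynomial (Vars1 p q) A))))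

/-- The ideal generated by all entries of `W + Wᵀ`, `T + Tᵀ` and `T·W − 2π·I_q`. -/
def ideal2 : Ideal (MvPolynomial (Vars2 q) A) :=
  Ideal.span (matEntries (Wmat2 A q + (Wmat2 A q)ᵀ) ∪
    matEntries (Tmat2 A q + (Tmat2 A q)ᵀ) ∪
    matEntries (Tmat2 A q * Wmat2 A q -
      (2 * π) • (1 : Matrix (Fin q) (Fin q) (MvPolynomial (Vars2 q) A))))

variable {A p q} in
def lift1 {Q : Type*} [CommRing Q] [Algebra A Q] (x y : Matrix (Fin p) (Fin q) Q)
    (z w : Matrix (Fin q) (Fin q) Q) (h1 : w + wᵀ = 0)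
    (h2 : (z - zᵀ + xᵀ * y - yᵀ * x) * w - (2 * π) • (1 : Matrix (Fin q) (Fin q) Q) = 0) :
    (MvPolynomial (Vars1 p q) A ⧸ ideal1 A π p q) →ₐ[A] Q :=
  Ideal.Quotient.liftₐ _ (aeval (Sum.elim (fun i => x i.1 i.2) (Sum.elim (fun i => y i.1 i.2)
    (Sum.elim (fun i => z i.1 i.2) (fun i => w i.1 i.2))))) (by
    intro a ha
    rw [← RingHom.mem_ker]
    revert a
    change ideal1 A π p q ≤ _
    rw [ideal1, Ideal.span_le]
    rintro _ (⟨⟨i, j⟩, rfl⟩ | ⟨⟨i, j⟩, rfl⟩)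
    · have := congrFun (congrFun h1 i) j
      simpa [RingHom.mem_ker, Wmat1] using this
    · have := congrFun (congrFun h2 i) j
      by_cases hij : i = j <;>
      simpa [RingHom.mem_ker, Wmat1, Zmat, Xmat, Ymat, Matrix.mul_apply, Matrix.one_apply,
        hij] using this)

variable {A q} in
def lift2 {Q : Type*} [CommRing Q] [Algebra A Q]
    (t w : Matrix (Fin q) (Fin q) Q) (h1 : w + wᵀ = 0) (h3 : t + tᵀ = 0)
    (h2 : t * w - (2 * π) • (1 : Matrix (Fin q) (Fin q) Q) = 0) :
    (MvPolynomial (Vars2 q) A ⧸ ideal2 A π q) →ₐ[A] Q :=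
  Ideal.Quotient.liftₐ _ (aeval (Sum.elim (fun i => t i.1 i.2) (fun i => w i.1 i.2))) (by
    intro a ha
    rw [← RingHom.mem_ker]
    revert a
    change ideal2 A π q ≤ _
    rw [ideal2, Ideal.span_le]
    rintro _ ((⟨⟨i, j⟩, rfl⟩ | ⟨⟨i, j⟩, rfl⟩) | ⟨⟨i, j⟩, rfl⟩)
    · have := congrFun (congrFun h1 i) j
      simpa [RingHom.mem_ker, Wmat2] using this
    · have := congrFun (congrFun h3 i) j
      simpa [RingHom.mem_ker, Tmat2] using this
    · have := congrFun (congrFun h2 i) j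
      by_cases hij : i = j <;>
      simpa [RingHom.mem_ker, Wmat2, Tmat2, Matrix.mul_apply, Matrix.one_apply,
        hij] using this)

abbrev P1 := MvPolynomial (Vars1 p q) A ⧸ ideal1 A π p q
abbrev P2 := MvPolynomial (Vars2 q) A ⧸ ideal2 A π q
abbrev V3 := (Fin p × Fin q) ⊕ ((Fin p × Fin q) ⊕ Sym2 (Fin q))

def x1 : Matrix (Fin p) (Fin q) (P1 A π p q) := (Xmat A p q).map (Ideal.Quotient.mkₐ A _)
def y1 : Matrix (Fin p) (Fin q) (P1 A π p q) := (Ymat A p q).map (Ideal.Quotient.mkₐ A _)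
def z1 : Matrix (Fin q) (Fin q) (P1 A π p q) := (Zmat A p q).map (Ideal.Quotient.mkₐ A _)
def w1 : Matrix (Fin q) (Fin q) (P1 A π p q) := (Wmat1 A p q).map (Ideal.Quotient.mkₐ A _)
def t2 : Matrix (Fin q) (Fin q) (P2 A π q) := (Tmat2 A q).map (Ideal.Quotient.mkₐ A _)
def w2 : Matrix (Fin q) (Fin q) (P2 A π q) := (Wmat2 A q).map (Ideal.Quotient.mkₐ A _)

theorem w1_rel : w1 A π p q + (w1 A π p q)ᵀ = 0 := by
  refine Matrix.ext fun i j => ?_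
  have : (Wmat1 A p q + (Wmat1 A p q)ᵀ) i j ∈ ideal1 A π p q :=
    Ideal.subset_span (Or.inl ⟨(i, j), rfl⟩)
  rw [← Ideal.Quotient.eq_zero_iff_mem] at this
  simpa [w1] using this

theorem z1_rel : (z1 A π p q - (z1 A π p q)ᵀ + (x1 A π p q)ᵀ * y1 A π p q
    - (y1 A π p q)ᵀ * x1 A π p q) * w1 A π p q
    - (2 * π) • (1 : Matrix (Fin q) (Fin q) (P1 A π p q)) = 0 := by
  refine Matrix.ext fun i j => ?_
  have := Ideal.subset_span (α := MvPolynomial (Vars1 p q) A)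
    (s := matEntries (Wmat1 A p q + (Wmat1 A p q)ᵀ) ∪
    matEntries ((Zmat A p q - (Zmat A p q)ᵀ + (Xmat A p q)ᵀ * Ymat A p q -
        (Ymat A p q)ᵀ * Xmat A p q) * Wmat1 A p q -
      (2 * π) • (1 : Matrix (Fin q) (Fin q) (MvPolynomial (Vars1 p q) A)))) (Or.inr ⟨(i, j), rfl⟩)
  change _ ∈ ideal1 A π p q at this
  rw [← Ideal.Quotient.eq_zero_iff_mem, ← Ideal.Quotient.mkₐ_eq_mk A] at this
  simp only [Matrix.sub_apply, Matrix.smul_apply, Matrix.mul_apply, Matrix.add_apply,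
    Matrix.transpose_apply, map_sub, map_add, map_sum, map_mul, map_smul, Matrix.one_apply,
    apply_ite, map_one, map_zero] at this
  simp only [Matrix.sub_apply, Matrix.smul_apply, Matrix.mul_apply, Matrix.add_apply,
    Matrix.transpose_apply, Matrix.one_apply, apply_ite, z1, x1, y1, w1, Matrix.map_apply,
    Matrix.zero_apply]
  exact this

theorem w2_rel : w2 A π q + (w2 A π q)ᵀ = 0 := by
  refine Matrix.ext fun i j => ?_
  have : (Wmat2 A q + (Wmat2 A q)ᵀ) i j ∈ ideal2 A π q :=
    Ideal.subset_span (Or.inl (Or.inl ⟨(i, j), rfl⟩))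
  rw [← Ideal.Quotient.eq_zero_iff_mem] at this
  simpa [w2] using this

theorem t2_rel : t2 A π q + (t2 A π q)ᵀ = 0 := by
  refine Matrix.ext fun i j => ?_
  have : (Tmat2 A q + (Tmat2 A q)ᵀ) i j ∈ ideal2 A π q :=
    Ideal.subset_span (Or.inl (Or.inr ⟨(i, j), rfl⟩))
  rw [← Ideal.Quotient.eq_zero_iff_mem] at this
  simpa [t2] using this

theorem tw2_rel : t2 A π q * w2 A π q
    - (2 * π) • (1 : Matrix (Fin q) (Fin q) (P2 A π q)) = 0 := by
  refine Matrix.ext fun i j => ?_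
  have : (Tmat2 A q * Wmat2 A q -
      (2 * π) • (1 : Matrix (Fin q) (Fin q) (MvPolynomial (Vars2 q) A))) i j ∈ ideal2 A π q :=
    Ideal.subset_span (Or.inr ⟨(i, j), rfl⟩)
  rw [← Ideal.Quotient.eq_zero_iff_mem, ← Ideal.Quotient.mkₐ_eq_mk A] at this
  simp only [Matrix.sub_apply, Matrix.smul_apply, Matrix.mul_apply,
    map_sub, map_sum, map_mul, map_smul, Matrix.one_apply,
    apply_ite, map_one, map_zero] at this
  simp only [Matrix.sub_apply, Matrix.smul_apply, Matrix.mul_apply,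
    Matrix.one_apply, apply_ite, t2, w2, Matrix.map_apply,
    Matrix.zero_apply]
  exact this

abbrev R3 := MvPolynomial (V3 p q) (P2 A π q)

def x3 : Matrix (Fin p) (Fin q) (R3 A π p q) := Matrix.of fun i j => X (Sum.inl (i, j))
def y3 : Matrix (Fin p) (Fin q) (R3 A π p q) := Matrix.of fun i j => X (Sum.inr (Sum.inl (i, j)))
def s3 : Matrix (Fin q) (Fin q) (R3 A π p q) := Matrix.of fun i j => X (Sum.inr (Sum.inr s(i, j)))
def toR3 : P2 A π q →ₐ[A] R3 A π p q := IsScalarTower.toAlgHom A (P2 A π q) (R3 A π p q)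
def t3 : Matrix (Fin q) (Fin q) (R3 A π p q) := (t2 A π q).map (toR3 A π p q)
def w3 : Matrix (Fin q) (Fin q) (R3 A π p q) := (w2 A π q).map (toR3 A π p q)
def z3 [Invertible (2 : A)] : Matrix (Fin q) (Fin q) (R3 A π p q) :=
  (⅟2 : A) • (t3 A π p q + s3 A π p q - (x3 A π p q)ᵀ * y3 A π p q + (y3 A π p q)ᵀ * x3 A π p q)

theorem w3_rel : w3 A π p q + (w3 A π p q)ᵀ = 0 := by
  refine Matrix.ext fun i j => ?_
  have := congrArg (toR3 A π p q) (congrFun (congrFun (w2_rel A π q) i) j)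
  simpa [w3] using this

theorem t3_rel : t3 A π p q + (t3 A π p q)ᵀ = 0 := by
  refine Matrix.ext fun i j => ?_
  have := congrArg (toR3 A π p q) (congrFun (congrFun (t2_rel A π q) i) j)
  simpa [t3] using this

theorem tw3_rel : t3 A π p q * w3 A π p q
    - (2 * π) • (1 : Matrix (Fin q) (Fin q) (R3 A π p q)) = 0 := by
  have := congrArg (toR3 A π p q).mapMatrix (tw2_rel A π q)
  rw [map_sub, map_mul, map_smul, map_one, map_zero] at this
  exact this

theorem s3_symm : (s3 A π p q)ᵀ = s3 A π p q := by
  refine Matrix.ext fun i j => ?_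
  simp [s3, Sym2.eq_swap]

theorem gen_sub {Q : Type*} [CommRing Q] [Algebra A Q] [Invertible (2 : A)]
    (T S M N : Matrix (Fin q) (Fin q) Q) :
    (⅟2 : A) • (T + S - M + N) - (⅟2 : A) • (-T + S - N + M) + M - N = T := by
  have h3 : (T + S - M + N) - (-T + S - N + M) = (T - M + N) + (T - M + N) := by abel
  rw [← smul_sub, h3, ← two_smul A, smul_smul, invOf_mul_self, one_smul]
  abel

theorem z3_sub [Invertible (2 : A)] : z3 A π p q - (z3 A π p q)ᵀ + (x3 A π p q)ᵀ * y3 A π p q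
    - (y3 A π p q)ᵀ * x3 A π p q = t3 A π p q := by
  have ht : (t3 A π p q)ᵀ = - t3 A π p q := by
    refine Matrix.ext fun i j => ?_
    have h : t3 A π p q i j + t3 A π p q j i = 0 := congrFun (congrFun (t3_rel A π p q) i) j
    rw [Matrix.neg_apply, Matrix.transpose_apply]
    linear_combination h
  have h2 : ∀ M : Matrix (Fin q) (Fin q) (R3 A π p q), M = (⅟2 : A) • (M + M) := by
    intro M
    rw [← two_smul A, smul_smul, invOf_mul_self, one_smul]
  simp only [z3, Matrix.transpose_smul, Matrix.transpose_add, Matrix.transpose_sub,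
    Matrix.transpose_mul, Matrix.transpose_transpose, ht, s3_symm]
  generalize (x3 A π p q)ᵀ * y3 A π p q = M
  generalize (y3 A π p q)ᵀ * x3 A π p q = N
  generalize t3 A π p q = T
  generalize s3 A π p q = S
  exact gen_sub A q T S M N

theorem z3_add [Invertible (2 : A)] : z3 A π p q + (z3 A π p q)ᵀ = s3 A π p q := by
  have ht : (t3 A π p q)ᵀ = - t3 A π p q := by
    refine Matrix.ext fun i j => ?_
    have h : t3 A π p q i j + t3 A π p q j i = 0 := congrFun (congrFun (t3_rel A π p q) i) j
    rw [Matrix.neg_apply, Matrix.transpose_apply]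
    linear_combination h
  have h2 : ∀ M : Matrix (Fin q) (Fin q) (R3 A π p q), M = (⅟2 : A) • (M + M) := by
    intro M
    rw [← two_smul A, smul_smul, invOf_mul_self, one_smul]
  simp only [z3, Matrix.transpose_smul, Matrix.transpose_add, Matrix.transpose_sub,
    Matrix.transpose_mul, Matrix.transpose_transpose, ht, s3_symm]
  conv_rhs => rw [h2 (s3 A π p q)]
  rw [← smul_add]
  congr 1
  abel

def Fmap [Invertible (2 : A)] : P1 A π p q →ₐ[A] R3 A π p q :=
  lift1 π (x3 A π p q) (y3 A π p q) (z3 A π p q) (w3 A π p q) (w3_rel A π p q)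
    (by rw [z3_sub]; exact tw3_rel A π p q)

def t1 : Matrix (Fin q) (Fin q) (P1 A π p q) :=
  z1 A π p q - (z1 A π p q)ᵀ + (x1 A π p q)ᵀ * y1 A π p q - (y1 A π p q)ᵀ * x1 A π p q

def G0 : P2 A π q →ₐ[A] P1 A π p q :=
  lift2 π (t1 A π p q) (w1 A π p q) (w1_rel A π p q)
    (by simp only [t1, Matrix.transpose_add, Matrix.transpose_sub,
          Matrix.transpose_mul, Matrix.transpose_transpose]
        abel) (z1_rel A π p q)

def Gmap : R3 A π p q →ₐ[A] P1 A π p q :=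
  aevalTower (G0 A π p q) (Sum.elim (fun i => x1 A π p q i.1 i.2)
    (Sum.elim (fun i => y1 A π p q i.1 i.2)
      (Sym2.lift ⟨fun i j => z1 A π p q i j + z1 A π p q j i, fun _ _ => add_comm _ _⟩)))

section evals
variable [Invertible (2 : A)]

theorem F_x (i j) : Fmap A π p q (x1 A π p q i j) = x3 A π p q i j := by
  exact (Ideal.Quotient.lift_mk _ _ _).trans (aeval_X _ (Sum.inl (i, j)))
theorem F_y (i j) : Fmap A π p q (y1 A π p q i j) = y3 A π p q i j := by
  exact (Ideal.Quotient.lift_mk _ _ _).trans (aeval_X _ (Sum.inr (Sum.inl (i, j))))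
theorem F_z (i j) : Fmap A π p q (z1 A π p q i j) = z3 A π p q i j := by
  exact (Ideal.Quotient.lift_mk _ _ _).trans (aeval_X _ (Sum.inr (Sum.inr (Sum.inl (i, j)))))
theorem F_w (i j) : Fmap A π p q (w1 A π p q i j) = w3 A π p q i j := by
  exact (Ideal.Quotient.lift_mk _ _ _).trans (aeval_X _ (Sum.inr (Sum.inr (Sum.inr (i, j)))))
theorem G0_t (i j) : G0 A π p q (t2 A π q i j) = t1 A π p q i j := by
  exact (Ideal.Quotient.lift_mk _ _ _).trans (aeval_X _ (Sum.inl (i, j)))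
theorem G0_w (i j) : G0 A π p q (w2 A π q i j) = w1 A π p q i j := by
  exact (Ideal.Quotient.lift_mk _ _ _).trans (aeval_X _ (Sum.inr (i, j)))
theorem G_to (a) : Gmap A π p q (toR3 A π p q a) = G0 A π p q a := by
  simp [Gmap, toR3, MvPolynomial.algebraMap_eq]
theorem G_x (i j) : Gmap A π p q (x3 A π p q i j) = x1 A π p q i j := by
  simp [Gmap, x3]
theorem G_y (i j) : Gmap A π p q (y3 A π p q i j) = y1 A π p q i j := by
  simp [Gmap, y3]
theorem G_s (i j) : Gmap A π p q (s3 A π p q i j) = z1 A π p q i j + z1 A π p q j i := by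
  simp [Gmap, s3]
theorem G_t (i j) : Gmap A π p q (t3 A π p q i j) = t1 A π p q i j := by
  simp only [t3, Matrix.map_apply, G_to, G0_t]
theorem G_w (i j) : Gmap A π p q (w3 A π p q i j) = w1 A π p q i j := by
  simp only [w3, Matrix.map_apply, G_to, G0_w]

theorem G_z (i j) : Gmap A π p q (z3 A π p q i j) = z1 A π p q i j := by
  have h2 : ∀ M : P1 A π p q, M = (⅟2 : A) • (M + M) := by
    intro M
    rw [← two_smul A, smul_smul, invOf_mul_self, one_smul]
  rw [h2 (z1 A π p q i j)]
  simp only [z3, Matrix.smul_apply, Matrix.add_apply, Matrix.sub_apply, Matrix.mul_apply,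
    Matrix.transpose_apply, map_smul, map_add, map_sub, map_sum, map_mul, G_x, G_y, G_s, G_t, t1]
  congr 1
  abel

theorem F_t (i j) : Fmap A π p q (t1 A π p q i j) = t3 A π p q i j := by
  rw [← z3_sub]
  simp only [t1, Matrix.add_apply, Matrix.sub_apply, Matrix.mul_apply,
    Matrix.transpose_apply, map_add, map_sub, map_sum, map_mul, F_x, F_y, F_z]

theorem GF : (Gmap A π p q).comp (Fmap A π p q) = AlgHom.id A _ := by
  apply Ideal.Quotient.algHom_ext
  apply MvPolynomial.algHom_ext
  rintro (⟨i, j⟩ | ⟨i, j⟩ | ⟨i, j⟩ | ⟨i, j⟩)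
  · change Gmap A π p q (Fmap A π p q (x1 A π p q i j)) = x1 A π p q i j
    rw [F_x, G_x]
  · change Gmap A π p q (Fmap A π p q (y1 A π p q i j)) = y1 A π p q i j
    rw [F_y, G_y]
  · change Gmap A π p q (Fmap A π p q (z1 A π p q i j)) = z1 A π p q i j
    rw [F_z, G_z]
  · change Gmap A π p q (Fmap A π p q (w1 A π p q i j)) = w1 A π p q i j
    rw [F_w, G_w]

theorem FG : (Fmap A π p q).comp (Gmap A π p q) = AlgHom.id A _ := by
  apply MvPolynomial.algHom_ext'
  · apply Ideal.Quotient.algHom_ext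
    apply MvPolynomial.algHom_ext
    rintro (⟨i, j⟩ | ⟨i, j⟩)
    · change Fmap A π p q (Gmap A π p q (t3 A π p q i j)) = t3 A π p q i j
      rw [G_t, F_t]
    · change Fmap A π p q (Gmap A π p q (w3 A π p q i j)) = w3 A π p q i j
      rw [G_w, F_w]
  · rintro (⟨i, j⟩ | ⟨i, j⟩ | s)
    · change Fmap A π p q (Gmap A π p q (x3 A π p q i j)) = x3 A π p q i j
      rw [G_x, F_x]
    · change Fmap A π p q (Gmap A π p q (y3 A π p q i j)) = y3 A π p q i j
      rw [G_y, F_y]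
    · induction s with
      | _ i j =>
      change Fmap A π p q (Gmap A π p q (s3 A π p q i j)) = s3 A π p q i j
      rw [G_s, map_add, F_z, F_z, ← z3_add]
      rfl
end evals

theorem card_V3 : Fintype.card (V3 p q) = 2 * p * q + q * (q + 1) / 2 := by
  simp only [Fintype.card_sum, Fintype.card_prod, Fintype.card_fin, Sym2.card,
    Nat.choose_two_right, Nat.add_sub_cancel]
  rw [mul_comm (q + 1) q]
  ring

/-- first chain of isomorphisms in the proof of Theorem 5.1 of the
paper: `P₁` is a polynomial ring over `P₂` in `2pq + q(q+1)/2` variables. -/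
theorem statement5 [Invertible (2 : A)] :
    Nonempty ((MvPolynomial (Vars1 p q) A ⧸ ideal1 A π p q) ≃ₐ[A]
      MvPolynomial (Fin (2 * p * q + q * (q + 1) / 2))
        (MvPolynomial (Vars2 q) A ⧸ ideal2 A π q)) := by
  exact ⟨(AlgEquiv.ofAlgHom (Fmap A π p q) (Gmap A π p q) (FG A π p q) (GF A π p q)).trans
    ((MvPolynomial.renameEquiv (P2 A π q)
      (Fintype.equivFinOfCardEq (card_V3 p q))).restrictScalars A)⟩

end
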